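/- Let (ω₁, ω₂) ∈ A_{(2,2)} on ℝ^n with ν = ω₁^{1/2}ω₂^{1/2}. Then [ω₁^{−1}]_{A₄} ≤ [ω₁,ω₂]²_{A_{(2,2)}}, [ω₂^{−1}]_{A₄} ≤ [ω₁,ω₂]²_{A_{(2,2)}}, and [ν]_{A₂} ≤ [ω₁,ω₂]²_{A_{(2,2)}}. -/

import Mathlib

open MeasureTheory ENNReal Filter Set
open scoped ENNReal NNReal

noncomputable section

/-- Euclidean space ℝⁿ. -/
abbrev Euc (n : ℕ) := EuclideanSpace ℝ (Fin n)

/-- The axis-parallel cube with center `c` and half side-length `h`. -/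
def cube {n : ℕ} (c : Euc n) (h : ℝ) : Set (Euc n) := {x | ∀ i, |x i - c i| ≤ h}

/-- A weight: a locally integrable, a.e. positive function. -/
def IsWeight {n : ℕ} (w : Euc n → ℝ) : Prop :=
  LocallyIntegrable w volume ∧ ∀ᵐ x : Euc n ∂volume, 0 < w x

/-- Average of (the nonnegative part of) `w` over the cube `cube c h`, valued in `ℝ≥0∞`. -/
def eAvg {n : ℕ} (w : Euc n → ℝ) (c : Euc n) (h : ℝ) : ℝ≥0∞ :=
  (∫⁻ x in cube c h, ENNReal.ofReal (w x)) / volume (cube c h)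

/-- Conjugate exponent `p' = p/(p-1)`. -/
def conjExp (p : ℝ) : ℝ := p / (p - 1)

/-- The `A_p` ratio over a fixed cube. -/
def apRatio {n : ℕ} (p : ℝ) (w : Euc n → ℝ) (c : Euc n) (h : ℝ) : ℝ≥0∞ :=
  eAvg w c h * (eAvg (fun x => w x ^ (1 - conjExp p)) c h) ^ (p - 1)

/-- The Muckenhoupt `A_p` constant. -/
def apConst (n : ℕ) (p : ℝ) (w : Euc n → ℝ) : ℝ≥0∞ :=
  ⨆ (c : Euc n) (h : ℝ) (_ : 0 < h), apRatio p w c h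

/-- Hardy–Littlewood maximal function (over cubes), `ℝ≥0∞`-valued. -/
def hlMax {n : ℕ} (f : Euc n → ℝ) (x : Euc n) : ℝ≥0∞ :=
  ⨆ (c : Euc n) (h : ℝ) (_ : 0 < h) (_ : x ∈ cube c h),
    (∫⁻ y in cube c h, ENNReal.ofReal |f y|) / volume (cube c h)

/-- The Fujii–Wilson `B_∞` ratio over a fixed cube. -/
def bRatio {n : ℕ} (w : Euc n → ℝ) (c : Euc n) (h : ℝ) : ℝ≥0∞ :=
  (∫⁻ x in cube c h, hlMax ((cube c h).indicator w) x) /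
    (∫⁻ x in cube c h, ENNReal.ofReal (w x))

/-- The Fujii–Wilson `B_∞` constant. -/
def bConst (n : ℕ) (w : Euc n → ℝ) : ℝ≥0∞ :=
  ⨆ (c : Euc n) (h : ℝ) (_ : 0 < h), bRatio w c h

/-- The bilinear `A_{(2,2)}` ratio over a fixed cube. -/
def a22Ratio {n : ℕ} (w1 w2 : Euc n → ℝ) (c : Euc n) (h : ℝ) : ℝ≥0∞ :=
  eAvg (fun x => w1 x ^ ((1:ℝ)/2) * w2 x ^ ((1:ℝ)/2)) c h *
    ((eAvg (fun x => (w1 x)⁻¹) c h) ^ ((1:ℝ)/2) * (eAvg (fun x => (w2 x)⁻¹) c h) ^ ((1:ℝ)/2))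

/-- The bilinear `A_{(2,2)}` constant. -/
def a22Const (n : ℕ) (w1 w2 : Euc n → ℝ) : ℝ≥0∞ :=
  ⨆ (c : Euc n) (h : ℝ) (_ : 0 < h), a22Ratio w1 w2 c h

/-- Weighted `L²` norm, `ℝ≥0∞`-valued. -/
def wL2 {n : ℕ} (w f : Euc n → ℝ) : ℝ≥0∞ :=
  (∫⁻ x, ENNReal.ofReal (f x ^ 2 * w x)) ^ ((1:ℝ)/2)

/-- Weighted `L¹` norm, `ℝ≥0∞`-valued. -/
def wL1 {n : ℕ} (w f : Euc n → ℝ) : ℝ≥0∞ :=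
  ∫⁻ x, ENNReal.ofReal (|f x| * w x)

/-- The volume of a cube with half side-length `h` is `(2h)ⁿ`. -/
theorem volume_cube_eq {n : ℕ} (c : Euc n) (h : ℝ) :
    volume (cube c h) = ENNReal.ofReal (2 * h) ^ n := by
  have hset : cube c h = (WithLp.ofLp : Euc n → Fin n → ℝ) ⁻¹'
      (Icc (fun i => c i - h) (fun i => c i + h)) := by
    ext x
    simp only [cube, mem_ofPred_eq, mem_preimage, mem_Icc, Pi.le_def, ← forall_and, abs_le]
    refine forall_congr' fun i => ?_
    constructor <;> rintro ⟨h1, h2⟩ <;> constructor <;> linarith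
  rw [hset, (PiLp.volume_preserving_ofLp (Fin n)).measure_preimage
    measurableSet_Icc.nullMeasurableSet, Real.volume_Icc_pi]
  simp [show ∀ a : ℝ, a + h - (a - h) = 2 * h by intro a; ring]

/-- Hölder's inequality for averages over a cube. -/
theorem eAvg_le_rpow_mul_rpow {n : ℕ} {f g k : Euc n → ℝ} (hg : AEMeasurable g volume)
    (hk : AEMeasurable k volume) {p q : ℝ} (hp : 0 ≤ p) (hq : 0 ≤ q) (hpq : p + q = 1)
    (hf : ∀ᵐ x : Euc n, 0 ≤ g x ∧ 0 ≤ k x ∧ f x = g x ^ p * k x ^ q) (c : Euc n) (h : ℝ) :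
    eAvg f c h ≤ eAvg g c h ^ p * eAvg k c h ^ q := by
  unfold eAvg
  have hfg : ∫⁻ x in cube c h, ENNReal.ofReal (f x) =
      ∫⁻ x in cube c h, ENNReal.ofReal (g x) ^ p * ENNReal.ofReal (k x) ^ q := by
    refine lintegral_congr_ae (ae_restrict_of_ae ?_)
    filter_upwards [hf] with x ⟨hgx, hkx, hfx⟩
    rw [hfx, ENNReal.ofReal_mul (Real.rpow_nonneg hgx p),
      ENNReal.ofReal_rpow_of_nonneg hgx hp, ENNReal.ofReal_rpow_of_nonneg hkx hq]
  have holder := ENNReal.lintegral_mul_norm_pow_le (μ := volume.restrict (cube c h))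
    hg.ennreal_ofReal.restrict hk.ennreal_ofReal.restrict hp hq hpq
  have hV : (volume (cube c h))⁻¹ = (volume (cube c h))⁻¹ ^ p * (volume (cube c h))⁻¹ ^ q := by
    rw [← ENNReal.rpow_add_of_nonneg p q hp hq, hpq, ENNReal.rpow_one]
  rw [hfg, div_eq_mul_inv, div_eq_mul_inv, div_eq_mul_inv, ENNReal.mul_rpow_of_nonneg _ _ hp,
    ENNReal.mul_rpow_of_nonneg _ _ hq, mul_mul_mul_comm, ← hV]
  gcongr

theorem eAvg_one {n : ℕ} (c : Euc n) {h : ℝ} (hh : 0 < h) : eAvg (fun _ => 1) c h = 1 := by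
  unfold eAvg
  simp only [ENNReal.ofReal_one]
  rw [setLIntegral_one, volume_cube_eq]
  exact ENNReal.div_self (pow_ne_zero n (by simpa using hh)) (by finiteness)

theorem IsWeight.aemeasurable {n : ℕ} {w : Euc n → ℝ} (hw : IsWeight w) :
    AEMeasurable w volume :=
  hw.1.aestronglyMeasurable.aemeasurable

theorem a22Ratio_comm {n : ℕ} (w1 w2 : Euc n → ℝ) (c : Euc n) (h : ℝ) :
    a22Ratio w1 w2 c h = a22Ratio w2 w1 c h := by
  unfold a22Ratio
  simp only [mul_comm]

theorem a22Const_comm {n : ℕ} (w1 w2 : Euc n → ℝ) : a22Const n w1 w2 = a22Const n w2 w1 := by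
  unfold a22Const
  simp only [a22Ratio_comm w1 w2]

theorem a22Ratio_le_a22Const {n : ℕ} (w1 w2 : Euc n → ℝ) (c : Euc n) {h : ℝ} (hh : 0 < h) :
    a22Ratio w1 w2 c h ≤ a22Const n w1 w2 :=
  le_iSup_of_le c (le_iSup_of_le h (le_iSup_of_le hh le_rfl))

theorem apRatio_four_inv_le {n : ℕ} {w1 w2 : Euc n → ℝ} (hw1 : IsWeight w1) (hw2 : IsWeight w2)
    (c : Euc n) (h : ℝ) :
    apRatio 4 (fun x => (w1 x)⁻¹) c h ≤ a22Ratio w1 w2 c h ^ (2:ℝ) := by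
  have key : eAvg (fun x => (w1 x)⁻¹ ^ (1 - conjExp 4)) c h ≤
      eAvg (fun x => w1 x ^ ((1:ℝ)/2) * w2 x ^ ((1:ℝ)/2)) c h ^ ((2:ℝ)/3) *
        eAvg (fun x => (w2 x)⁻¹) c h ^ ((1:ℝ)/3) := by
    refine eAvg_le_rpow_mul_rpow
      ((hw1.aemeasurable.pow_const _).mul (hw2.aemeasurable.pow_const _))
      hw2.aemeasurable.inv (by norm_num) (by norm_num) (by norm_num) ?_ c h
    filter_upwards [hw1.2, hw2.2] with x h1 h2
    simp only [Pi.mul_apply, Pi.inv_apply]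
    refine ⟨by positivity, by positivity, ?_⟩
    rw [Real.mul_rpow (by positivity) (by positivity), ← Real.rpow_mul h1.le,
      ← Real.rpow_mul h2.le, Real.inv_rpow h1.le, Real.inv_rpow h2.le, ← Real.rpow_neg h1.le,
      mul_assoc, conjExp]
    norm_num
    rw [mul_inv_cancel₀ (by positivity), mul_one]
  calc apRatio 4 (fun x => (w1 x)⁻¹) c h
      ≤ eAvg (fun x => (w1 x)⁻¹) c h *
        (eAvg (fun x => w1 x ^ ((1:ℝ)/2) * w2 x ^ ((1:ℝ)/2)) c h ^ ((2:ℝ)/3) *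
          eAvg (fun x => (w2 x)⁻¹) c h ^ ((1:ℝ)/3)) ^ ((4:ℝ) - 1) := by
        unfold apRatio
        gcongr
    _ = a22Ratio w1 w2 c h ^ (2:ℝ) := by
        unfold a22Ratio
        rw [ENNReal.mul_rpow_of_nonneg _ _ (by norm_num),
          ENNReal.mul_rpow_of_nonneg _ _ (by norm_num),
          ENNReal.mul_rpow_of_nonneg _ _ (by norm_num)]
        simp only [← ENNReal.rpow_mul]
        norm_num
        ring

theorem apRatio_two_le {n : ℕ} {w1 w2 : Euc n → ℝ} (hw1 : IsWeight w1) (hw2 : IsWeight w2)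
    (c : Euc n) (h : ℝ) :
    apRatio 2 (fun x => w1 x ^ ((1:ℝ)/2) * w2 x ^ ((1:ℝ)/2)) c h ≤ a22Ratio w1 w2 c h := by
  unfold apRatio a22Ratio
  rw [show (2:ℝ) - 1 = 1 by norm_num, ENNReal.rpow_one]
  gcongr
  refine eAvg_le_rpow_mul_rpow hw1.aemeasurable.inv hw2.aemeasurable.inv
    (by norm_num) (by norm_num) (by norm_num) ?_ c h
  filter_upwards [hw1.2, hw2.2] with x h1 h2
  simp only [Pi.inv_apply]
  refine ⟨by positivity, by positivity, ?_⟩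
  rw [show 1 - conjExp 2 = -1 by norm_num [conjExp], Real.rpow_neg_one, mul_inv,
    Real.inv_rpow h1.le, Real.inv_rpow h2.le]

theorem one_le_apRatio_two {n : ℕ} {w : Euc n → ℝ} (hw : AEMeasurable w volume)
    (hpos : ∀ᵐ x : Euc n, 0 < w x) (c : Euc n) {h : ℝ} (hh : 0 < h) :
    1 ≤ apRatio 2 w c h := by
  have key : eAvg (fun _ => 1) c h ≤
      eAvg w c h ^ ((1:ℝ)/2) * eAvg (fun x => w x ^ (1 - conjExp 2)) c h ^ ((1:ℝ)/2) := by
    refine eAvg_le_rpow_mul_rpow hw (hw.pow_const _)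
      (by norm_num) (by norm_num) (by norm_num) ?_ c h
    filter_upwards [hpos] with x hx
    refine ⟨by positivity, by positivity, ?_⟩
    rw [show 1 - conjExp 2 = -1 by norm_num [conjExp], Real.rpow_neg_one, Real.inv_rpow hx.le,
      mul_inv_cancel₀ (by positivity)]
  rw [eAvg_one c hh, ← ENNReal.mul_rpow_of_nonneg _ _ (by norm_num)] at key
  unfold apRatio
  rw [show (2:ℝ) - 1 = 1 by norm_num, ENNReal.rpow_one]
  by_contra! hlt
  exact absurd key (not_le.mpr (ENNReal.rpow_lt_one hlt (by norm_num)))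

theorem apConst_four_inv_le {n : ℕ} {w1 w2 : Euc n → ℝ} (hw1 : IsWeight w1)
    (hw2 : IsWeight w2) :
    apConst n 4 (fun x => (w1 x)⁻¹) ≤ a22Const n w1 w2 ^ (2:ℝ) :=
  iSup_le fun c => iSup_le fun h => iSup_le fun hh =>
    (apRatio_four_inv_le hw1 hw2 c h).trans
      (ENNReal.rpow_le_rpow (a22Ratio_le_a22Const w1 w2 c hh) (by norm_num))

theorem apConst_two_le {n : ℕ} {w1 w2 : Euc n → ℝ} (hw1 : IsWeight w1) (hw2 : IsWeight w2) :
    apConst n 2 (fun x => w1 x ^ ((1:ℝ)/2) * w2 x ^ ((1:ℝ)/2)) ≤ a22Const n w1 w2 ^ (2:ℝ) := by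
  refine iSup_le fun c => iSup_le fun h => iSup_le fun hh => ?_
  have hle := (apRatio_two_le hw1 hw2 c h).trans (a22Ratio_le_a22Const w1 w2 c hh)
  have hone : 1 ≤ a22Const n w1 w2 := by
    refine (one_le_apRatio_two
      ((hw1.aemeasurable.pow_const _).mul (hw2.aemeasurable.pow_const _)) ?_ c hh).trans hle
    filter_upwards [hw1.2, hw2.2] with x h1 h2
    simp only [Pi.mul_apply]
    positivity
  calc _ ≤ a22Const n w1 w2 ^ (1:ℝ) := by rwa [ENNReal.rpow_one]
    _ ≤ a22Const n w1 w2 ^ (2:ℝ) := ENNReal.rpow_le_rpow_of_exponent_le hone (by norm_num)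

/-- Quantitative form of the characterization of `A_{(2,2)}`.
If `(ω₁, ω₂) ∈ A_{(2,2)}` and `ν = ω₁^{1/2} ω₂^{1/2}`, then
`[ω₁⁻¹]_{A₄}, [ω₂⁻¹]_{A₄}, [ν]_{A₂} ≤ [ω₁,ω₂]²_{A_{(2,2)}}`. -/
theorem a22_quantitative_bounds (n : ℕ) (w1 w2 : Euc n → ℝ)
    (hw1 : IsWeight w1) (hw2 : IsWeight w2) (hA : a22Const n w1 w2 < ⊤) :
    apConst n 4 (fun x => (w1 x)⁻¹) ≤ (a22Const n w1 w2) ^ (2:ℝ) ∧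
      apConst n 4 (fun x => (w2 x)⁻¹) ≤ (a22Const n w1 w2) ^ (2:ℝ) ∧
      apConst n 2 (fun x => w1 x ^ ((1:ℝ)/2) * w2 x ^ ((1:ℝ)/2)) ≤ (a22Const n w1 w2) ^ (2:ℝ) := by
  exact ⟨apConst_four_inv_le hw1 hw2, a22Const_comm w1 w2 ▸ apConst_four_inv_le hw2 hw1,
    apConst_two_le hw1 hw2⟩
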